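/- arXiv:0807.0007 — 9 statements merged into one kernel-verified Lean document; each statement's English description precedes it below -/
import Mathlib

section
/- Suppose that no vertex of G is adjacent to all of the other n−1 vertices of G, let h = n(n+1) + d, and let S_1, …, S_h be a clique minor of order h in G'. Then each set S_i contains exactly one vertex that is not a middle vertex, and every non-middle vertex of G' (i.e., every top or bottom vertex) belongs to exactly one of the sets S_i. -/
/-- The vertex type of the graph `G'` built from a graph `G` on `Fin n` and a parameter `d`:
`d` top vertices, `n` middle vertices, and `n * (n+1)` bottom vertices `b_{i,j}`. -/
abbrev HVert (n d : ℕ) := Fin d ⊕ Fin n ⊕ Fin n × Fin (n + 1)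

/-- Generating relation for the edges of `G'`: all pairs of distinct top vertices, all
top–middle pairs, all pairs of distinct bottom vertices, and a middle vertex `m i` adjacent
to a bottom vertex `b_{j,k}` iff `i = j` or `v_i v_j` is an edge of `G`. -/
def hRel (n d : ℕ) (G : SimpleGraph (Fin n)) : HVert n d → HVert n d → Prop
  | Sum.inl _, Sum.inl _ => True
  | Sum.inl _, Sum.inr (Sum.inl _) => True
  | Sum.inr (Sum.inl i), Sum.inr (Sum.inr p) => i = p.1 ∨ G.Adj i p.1
  | Sum.inr (Sum.inr _), Sum.inr (Sum.inr _) => True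
  | _, _ => False

/-- The graph `G'` of the reduction from domatic number to Hadwiger number. -/
def Gp (n d : ℕ) (G : SimpleGraph (Fin n)) : SimpleGraph (HVert n d) :=
  SimpleGraph.fromRel (hRel n d G)

/-- A clique minor of order `h` in `H`, given as a family of `h` pairwise disjoint nonempty
vertex subsets, each inducing a connected subgraph, with an edge of `H` between every two
of the subsets. -/
def IsCliqueMinorFam {V : Type*} (H : SimpleGraph V) {h : ℕ} (S : Fin h → Set V) : Prop :=
  (∀ i, (S i).Nonempty) ∧
  (∀ i, (H.induce (S i)).Connected) ∧
  (∀ i j, i ≠ j → Disjoint (S i) (S j)) ∧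
  (∀ i j, i ≠ j → ∃ u ∈ S i, ∃ v ∈ S j, H.Adj u v)

/-- `D` is a dominating set of `G`: every vertex is equal or adjacent to a member of `D`. -/
def IsDomSet {V : Type*} (G : SimpleGraph V) (D : Set V) : Prop :=
  ∀ w, ∃ v ∈ D, v = w ∨ G.Adj v w

/-- A vertex of `G'` is a middle vertex. -/
def IsMiddle (n d : ℕ) (v : HVert n d) : Prop := ∃ j : Fin n, v = Sum.inr (Sum.inl j)

/-- Embedding of the non-middle vertices. -/
def nonMid (n d : ℕ) : Fin d ⊕ Fin n × Fin (n + 1) → HVert n d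
  | Sum.inl t => Sum.inl t
  | Sum.inr p => Sum.inr (Sum.inr p)

theorem exists_nonMid (n d : ℕ) (v : HVert n d) (hv : ¬ IsMiddle n d v) :
    ∃ x, nonMid n d x = v := by
  rcases v with t | i | p
  · exact ⟨Sum.inl t, rfl⟩
  · exact absurd ⟨i, rfl⟩ hv
  · exact ⟨Sum.inr p, rfl⟩

theorem nonMid_not_middle (n d : ℕ) (x) : ¬ IsMiddle n d (nonMid n d x) := by
  rintro ⟨j, hj⟩
  rcases x with t | p <;> simp [nonMid] at hj

theorem not_adj_middle (n d : ℕ) (G : SimpleGraph (Fin n)) (u v : HVert n d)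
    (hu : IsMiddle n d u) (hv : IsMiddle n d v) : ¬ (Gp n d G).Adj u v := by
  obtain ⟨i, rfl⟩ := hu
  obtain ⟨j, rfl⟩ := hv
  simp [Gp, hRel]

/-- If no vertex of `G` is adjacent to all others and `S` is a clique minor of order
`h = n(n+1) + d` in `G'`, then each set of the family contains exactly one non-middle
vertex, and each non-middle vertex of `G'` lies in exactly one set of the family. -/
theorem stmt3 (n d : ℕ) (hd : 1 ≤ d) (G : SimpleGraph (Fin n))
    (hG : ∀ v : Fin n, ∃ w : Fin n, w ≠ v ∧ ¬ G.Adj v w)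
    (S : Fin (n * (n + 1) + d) → Set (HVert n d))
    (hS : IsCliqueMinorFam (Gp n d G) S) :
    (∀ a, ∃! v : HVert n d, v ∈ S a ∧ ¬ IsMiddle n d v) ∧
      (∀ v : HVert n d, ¬ IsMiddle n d v → ∃! a, v ∈ S a) := by
  obtain ⟨hne, hcon, hdis, hadj⟩ := hS
  have huniq : ∀ a b v, v ∈ S a → v ∈ S b → a = b := by
    intro a b v ha hb
    by_contra hab
    exact Set.disjoint_left.1 (hdis a b hab) ha hb
  have hex : ∀ a, ∃ x, nonMid n d x ∈ S a := by
    intro a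
    by_contra! hno
    have hmid : ∀ v ∈ S a, IsMiddle n d v := by
      intro v hv
      by_contra hvm
      obtain ⟨x, rfl⟩ := exists_nonMid n d v hvm
      exact hno x hv
    obtain ⟨u, hu⟩ := hne a
    obtain ⟨i, hi⟩ := hmid u hu
    have hsing : ∀ v ∈ S a, v = u := by
      intro v hv
      obtain ⟨p⟩ := (hcon a).preconnected ⟨v, hv⟩ ⟨u, hu⟩
      cases p with
      | nil => rfl
      | @cons _ w _ hvw _ =>
        exact absurd hvw (not_adj_middle n d G _ _ (hmid v hv) (hmid _ w.2))
    obtain ⟨w, hwi, hw⟩ := hG i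
    have hnb : ∀ b : {b // b ≠ a}, ∃ x, nonMid n d x ∈ S b ∧ ∀ k, x ≠ Sum.inr (w, k) := by
      rintro ⟨b, hb⟩
      obtain ⟨v, hv, y, hy, hvy⟩ := hadj a b (Ne.symm hb)
      obtain rfl := hsing v hv
      have hym : ¬ IsMiddle n d y := fun hm => not_adj_middle n d G _ _ ⟨i, hi⟩ hm hvy
      obtain ⟨x, rfl⟩ := exists_nonMid n d y hym
      refine ⟨x, hy, ?_⟩
      rintro k rfl
      subst hi
      simp [Gp, hRel, nonMid, hwi.symm, hw] at hvy
    choose f hf hfw using hnb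
    let F : {b // b ≠ a} ⊕ Fin (n + 1) → Fin d ⊕ Fin n × Fin (n + 1) :=
      Sum.elim f (fun k => Sum.inr (w, k))
    have hF : Function.Injective F := by
      rintro (b | k) (c | l) h
      · have h' : f b = f c := h
        have := huniq b c _ (hf b) (h' ▸ hf c)
        rw [Subtype.ext this]
      · exact absurd h (hfw b l)
      · exact absurd h.symm (hfw c k)
      · simpa [F] using h
    have hc := Fintype.card_le_of_injective F hF
    have := i.pos
    simp [Fintype.card_subtype_compl] at hc
    omega
  choose f hf using hex
  have hinj : Function.Injective f := fun a b h => huniq a b _ (hf a) (h ▸ hf b)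
  have hbij : Function.Bijective f :=
    (Fintype.bijective_iff_injective_and_card f).2 ⟨hinj, by simp [add_comm]⟩
  refine ⟨fun a => ⟨nonMid n d (f a), ⟨hf a, nonMid_not_middle n d _⟩, ?_⟩, ?_⟩
  · rintro v ⟨hv, hvm⟩
    obtain ⟨x, rfl⟩ := exists_nonMid n d v hvm
    obtain ⟨b, rfl⟩ := hbij.2 x
    rw [huniq a b _ hv (hf b)]
  · intro v hvm
    obtain ⟨x, rfl⟩ := exists_nonMid n d v hvm
    obtain ⟨b, rfl⟩ := hbij.2 x
    exact ⟨b, hf b, fun c hc => huniq c b _ hc (hf b)⟩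
end

section
/- Suppose that no vertex of G is adjacent to all of the other n−1 vertices of G, let h = n(n+1) + d, and let S_1, …, S_h be a clique minor of order h in G'. Then for each i with 1 ≤ i ≤ n, there exists j with 1 ≤ j ≤ n+1 such that the singleton set {b_{i,j}} is one of the sets of the family. -/
/-- Embedding of the top and bottom vertices into the vertices of `G'`. -/
def tbEmb (n d : ℕ) : Fin d ⊕ (Fin n × Fin (n + 1)) → HVert n d
  | Sum.inl t => Sum.inl t
  | Sum.inr p => Sum.inr (Sum.inr p)

theorem tb_surj (n d : ℕ) (g : Fin (n * (n + 1) + d) → Fin d ⊕ (Fin n × Fin (n + 1)))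
    (hg : Function.Injective g) : Function.Surjective g := by
  have hc : Fintype.card (Fin (n * (n + 1) + d)) =
      Fintype.card (Fin d ⊕ (Fin n × Fin (n + 1))) := by
    simp [add_comm]
  exact ((Fintype.bijective_iff_injective_and_card g).2 ⟨hg, hc⟩).2

theorem no_mid (n d : ℕ) (G : SimpleGraph (Fin n))
    (hG : ∀ v : Fin n, ∃ w : Fin n, w ≠ v ∧ ¬ G.Adj v w)
    (S : Fin (n * (n + 1) + d) → Set (HVert n d))
    (hS : IsCliqueMinorFam (Gp n d G) S) (a : Fin (n * (n + 1) + d)) :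
    ∃ p, tbEmb n d p ∈ S a := by
  obtain ⟨hne, hcon, hdis, hadj⟩ := hS
  have hD : ∀ x a b, x ∈ S a → x ∈ S b → a = b := by
    intro x a b h1 h2
    by_contra h
    exact Set.disjoint_left.1 (hdis a b h) h1 h2
  by_contra hno
  push Not at hno
  have hmid : ∀ x ∈ S a, ∃ i : Fin n, x = Sum.inr (Sum.inl i) := by
    rintro (t | i | p) hx
    · exact absurd hx (hno (Sum.inl t))
    · exact ⟨i, rfl⟩
    · exact absurd hx (hno (Sum.inr p))
  obtain ⟨x, hx⟩ := hne a
  obtain ⟨i, rfl⟩ := hmid x hx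
  have hsing : ∀ y ∈ S a, y = Sum.inr (Sum.inl i) := by
    intro y hy
    obtain ⟨p⟩ := (hcon a).preconnected ⟨_, hx⟩ ⟨y, hy⟩
    cases p with
    | nil => rfl
    | @cons _ v _ h q =>
      exfalso
      obtain ⟨k, hk⟩ := hmid v.1 v.2
      have h' : (Gp n d G).Adj (Sum.inr (Sum.inl i)) v.1 := h
      rw [hk] at h'
      simp [Gp, hRel] at h'
  obtain ⟨w, hw, hnw⟩ := hG i
  have key : ∀ b, b ≠ a → ∃ p, tbEmb n d p ∈ S b ∧ ∀ k, p ≠ Sum.inr (w, k) := by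
    intro b hb
    obtain ⟨u, hu, v, hv, huv⟩ := hadj a b hb.symm
    rw [hsing u hu] at huv
    rcases v with t | k | ⟨q, k⟩
    · exact ⟨Sum.inl t, hv, by simp⟩
    · simp [Gp, hRel] at huv
    · refine ⟨Sum.inr (q, k), hv, ?_⟩
      intro k' hk'
      simp only [Sum.inr.injEq, Prod.mk.injEq] at hk'
      obtain ⟨rfl, -⟩ := hk'
      simp [Gp, hRel] at huv
      rcases huv with h | h
      · exact hw h.symm
      · exact hnw h
  haveI : Nonempty (Fin d ⊕ (Fin n × Fin (n + 1))) := ⟨Sum.inr (w, 0)⟩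
  choose! g hg1 hg2 using key
  have hsurj := tb_surj n d (fun b => if b = a then Sum.inr (w, 0) else g b) (by
    intro b c hbc
    by_cases h1 : b = a <;> by_cases h2 : c = a
    · rw [h1, h2]
    · simp only [h1, h2, if_true, if_false] at hbc
      exact absurd hbc.symm (hg2 c h2 0)
    · simp only [h1, h2, if_true, if_false] at hbc
      exact absurd hbc (hg2 b h1 0)
    · simp only [h1, h2, if_false] at hbc
      exact hD _ b c (hg1 b h1) (hbc ▸ hg1 c h2))
  obtain ⟨b, hb⟩ := hsurj (Sum.inr (w, Fin.last n))
  have hn : 0 < n := i.pos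
  by_cases h1 : b = a
  · simp only [h1, if_true, Sum.inr.injEq, Prod.mk.injEq, true_and] at hb
    have := congrArg Fin.val hb
    simp at this
    omega
  · simp only [h1, if_false] at hb
    exact hg2 b h1 _ hb

/-- If no vertex of `G` is adjacent to all others and `S` is a clique minor of order
`h = n(n+1) + d` in `G'`, then for every `i` some bottom vertex `b_{i,j}` forms a
single-vertex set of the family. -/
theorem stmt4 (n d : ℕ) (hd : 1 ≤ d) (G : SimpleGraph (Fin n))
    (hG : ∀ v : Fin n, ∃ w : Fin n, w ≠ v ∧ ¬ G.Adj v w)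
    (S : Fin (n * (n + 1) + d) → Set (HVert n d))
    (hS : IsCliqueMinorFam (Gp n d G) S) :
    ∀ i : Fin n, ∃ j : Fin (n + 1), ∃ a, S a = {Sum.inr (Sum.inr (i, j))} := by
  intro i
  have hD : ∀ x a b, x ∈ S a → x ∈ S b → a = b := by
    intro x a b h1 h2
    by_contra h
    exact Set.disjoint_left.1 (hS.2.2.1 a b h) h1 h2
  choose g hg using no_mid n d G hG S hS
  have hsurj := tb_surj n d g (by
    intro b c hbc
    exact hD _ b c (hg b) (hbc ▸ hg c))
  have huniq : ∀ a p, tbEmb n d p ∈ S a → p = g a := by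
    intro a p hp
    obtain ⟨b, rfl⟩ := hsurj p
    rw [hD _ a b hp (hg b)]
  by_contra hcon
  push Not at hcon
  have key : ∀ j : Fin (n + 1), ∃ m : Fin n, ∃ a,
      g a = Sum.inr (i, j) ∧ (Sum.inr (Sum.inl m) : HVert n d) ∈ S a := by
    intro j
    obtain ⟨a, ha⟩ := hsurj (Sum.inr (i, j))
    by_contra hno
    push Not at hno
    apply hcon j a
    have hmem := hg a
    rw [ha] at hmem
    refine Set.eq_singleton_iff_unique_mem.2 ⟨hmem, ?_⟩
    rintro (t | m | p) hx
    · have := huniq a (Sum.inl t) hx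
      rw [ha] at this
      cases this
    · exact absurd hx (hno m a ha)
    · have := huniq a (Sum.inr p) hx
      rw [ha] at this
      rw [Sum.inr.inj this]
  choose f a ha hf using key
  have hinj : Function.Injective f := by
    intro j k hjk
    have h1 := hD _ (a j) (a k) (hf j) (hjk ▸ hf k)
    have h2 := ha j
    rw [h1, ha k] at h2
    simpa using h2.symm
  have := Fintype.card_le_of_injective f hinj
  simp at this
end

section
/- Suppose that no vertex of G is adjacent to all of the other n−1 vertices of G, let h = n(n+1) + d, let S_1, …, S_h be a clique minor of order h in G', and suppose the top vertex t_i belongs to the set S_i of the family. Then the set D_i = {v_j : m_j ∈ S_i} is a dominating set of G. -/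
/-- Choosing representatives of pairwise disjoint sets is injective. -/
theorem exists_rep {V β : Type*} {h : ℕ} (S : Fin h → Set V)
    (hdis : ∀ i j, i ≠ j → Disjoint (S i) (S j)) (g : β → V)
    (hg : ∀ c, ∃ x, g x ∈ S c) :
    ∃ f : Fin h → β, Function.Injective f ∧ ∀ c, g (f c) ∈ S c := by
  choose f hf using hg
  refine ⟨f, ?_, hf⟩
  intro c c' hcc
  by_contra hne
  have h1 := hf c
  rw [hcc] at h1
  exact Set.disjoint_left.mp (hdis c c' hne) h1 (hf c')

/-- A property closed under adjacency inside a connected set spreads to the whole set. -/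
theorem conn_spread {V : Type*} {H : SimpleGraph V} {T : Set V} (hc : (H.induce T).Connected)
    (P : V → Prop) (hP : ∀ u ∈ T, ∀ v ∈ T, H.Adj u v → P u → P v)
    {u v : V} (hu : u ∈ T) (hv : v ∈ T) (h : P u) : P v := by
  obtain ⟨p⟩ := hc.preconnected ⟨u, hu⟩ ⟨v, hv⟩
  have : ∀ (x y : T), (H.induce T).Walk x y → P x → P y := by
    intro x y p
    induction p with
    | nil => exact id
    | cons hadj _ ih =>
      intro hx
      exact ih (hP _ (Subtype.property _) _ (Subtype.property _) hadj hx)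
  exact this _ _ p h

/-- If no vertex of `G` is adjacent to all others, `S` is a clique minor of order
`h = n(n+1) + d` in `G'`, and the top vertex `t i` belongs to the set `S a`, then the set of
vertices of `G` whose middle vertices lie in `S a` is a dominating set of `G`. -/
theorem stmt5 (n d : ℕ) (hd : 1 ≤ d) (G : SimpleGraph (Fin n))
    (hG : ∀ v : Fin n, ∃ w : Fin n, w ≠ v ∧ ¬ G.Adj v w)
    (S : Fin (n * (n + 1) + d) → Set (HVert n d))
    (hS : IsCliqueMinorFam (Gp n d G) S)
    (a : Fin (n * (n + 1) + d)) (i : Fin d) (hti : Sum.inl i ∈ S a) :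
    IsDomSet G {v : Fin n | Sum.inr (Sum.inl v) ∈ S a} := by
  obtain ⟨-, hcon, hdis, hadj⟩ := hS
  intro w
  have hn : 0 < n := lt_of_le_of_lt (Nat.zero_le _) w.2
  -- a set consisting only of bottom vertices
  have h0 : ∃ c0, ∀ x ∈ S c0, ∃ p, x = Sum.inr (Sum.inr p) := by
    by_contra hno
    push Not at hno
    obtain ⟨f, hf, -⟩ := exists_rep S hdis
      (fun x : Fin d ⊕ Fin n => (Sum.map id Sum.inl x : HVert n d)) (by
        intro c
        obtain ⟨x, hx, hx'⟩ := hno c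
        rcases x with t | m | b
        · exact ⟨Sum.inl t, hx⟩
        · exact ⟨Sum.inr m, hx⟩
        · exact absurd rfl (hx' b))
    have := Fintype.card_le_of_injective f hf
    simp only [Fintype.card_fin, Fintype.card_sum] at this
    nlinarith
  obtain ⟨c0, hc0⟩ := h0
  -- for every class there is a set inside that class
  have key : ∀ w : Fin n, ∃ c, ∀ x ∈ S c, ∃ k, x = Sum.inr (Sum.inr (w, k)) := by
    intro w
    by_contra hno
    push Not at hno
    obtain ⟨f, hf, -⟩ := exists_rep S hdis
      (fun x : Fin n ⊕ ({x : Fin n // x ≠ w} × Fin (n + 1)) =>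
        (Sum.inr (Sum.map id (fun q => (q.1.1, q.2)) x) : HVert n d)) (by
        intro c
        by_cases hm : ∃ m, (Sum.inr (Sum.inl m) : HVert n d) ∈ S c
        · obtain ⟨m, hm⟩ := hm
          exact ⟨Sum.inl m, hm⟩
        push Not at hm
        obtain ⟨x, hx, hx'⟩ := hno c
        rcases x with t | m | ⟨j, k⟩
        · exfalso
          have hne : c ≠ c0 := by
            rintro rfl
            obtain ⟨p, hp⟩ := hc0 _ hx
            cases hp
          obtain ⟨u, hu, v, hv, huv⟩ := hadj c c0 hne
          have hall : ∀ y ∈ S c, ∃ s, y = Sum.inl s := by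
            intro y hy
            refine conn_spread (hcon c) (fun y => ∃ s, y = Sum.inl s) ?_ hx hy ⟨t, rfl⟩
            rintro _ - y hy hadj ⟨s, rfl⟩
            rcases y with s' | m | b
            · exact ⟨s', rfl⟩
            · exact absurd hy (hm m)
            · simp [Gp, hRel] at hadj
          obtain ⟨s, rfl⟩ := hall u hu
          obtain ⟨p, rfl⟩ := hc0 v hv
          simp [Gp, hRel] at huv
        · exact absurd hx (hm m)
        · refine ⟨Sum.inr (⟨j, ?_⟩, k), hx⟩
          rintro rfl
          exact hx' k rfl)
    have := Fintype.card_le_of_injective f hf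
    simp only [Fintype.card_fin, Fintype.card_sum, Fintype.card_prod] at this
    have h2 : Fintype.card {x : Fin n // x ≠ w} = n - 1 := by
      simp [Fintype.card_subtype_compl]
    rw [h2] at this
    obtain ⟨n, rfl⟩ : ∃ m, n = m + 1 := ⟨n - 1, by omega⟩
    simp only [Nat.add_sub_cancel] at this
    nlinarith
  -- every set contains a top or a bottom vertex
  obtain ⟨f, hf, hfS⟩ := exists_rep S hdis
    (fun x : Fin d ⊕ (Fin n × Fin (n + 1)) => (Sum.map id Sum.inr x : HVert n d)) (by
      intro c
      by_contra hno
      push Not at hno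
      have hmid : ∀ y ∈ S c, ∃ m, y = Sum.inr (Sum.inl m) := by
        intro y hy
        rcases y with t | m | b
        · exact absurd hy (hno (Sum.inl t))
        · exact ⟨m, rfl⟩
        · exact absurd hy (hno (Sum.inr b))
      obtain ⟨⟨x, hx⟩⟩ := (hcon c).nonempty
      obtain ⟨m, rfl⟩ := hmid x hx
      have hall : ∀ y ∈ S c, y = Sum.inr (Sum.inl m) := by
        intro y hy
        refine conn_spread (hcon c) (fun y => y = Sum.inr (Sum.inl m)) ?_ hx hy rfl
        rintro _ - y hy hadj rfl
        obtain ⟨m', rfl⟩ := hmid y hy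
        simp [Gp, hRel] at hadj
      obtain ⟨w, hw, hmw⟩ := hG m
      obtain ⟨c', hc'⟩ := key w
      have hne : c ≠ c' := by
        rintro rfl
        obtain ⟨k, hk⟩ := hc' _ hx
        simp at hk
      obtain ⟨u, hu, v, hv, huv⟩ := hadj c c' hne
      obtain rfl := hall u hu
      obtain ⟨k, rfl⟩ := hc' v hv
      simp [Gp, hRel, hmw, hw.symm] at huv)
  have hsurj : Function.Surjective f := by
    refine ((Fintype.bijective_iff_injective_and_card f).mpr ⟨hf, ?_⟩).2
    simp only [Fintype.card_fin, Fintype.card_sum, Fintype.card_prod]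
    ring
  have huniq : ∀ x, Sum.map id Sum.inr x ∈ S a → f a = x := by
    intro x hx
    obtain ⟨c, rfl⟩ := hsurj x
    by_contra hne
    have hca : c ≠ a := by
      rintro rfl
      exact hne rfl
    exact Set.disjoint_left.mp (hdis c a hca) (hfS c) hx
  have htop : f a = Sum.inl i := huniq (Sum.inl i) hti
  obtain ⟨c, hc⟩ := key w
  have hne : a ≠ c := by
    rintro rfl
    obtain ⟨k, hk⟩ := hc _ hti
    cases hk
  obtain ⟨u, hu, v, hv, huv⟩ := hadj a c hne
  obtain ⟨k, rfl⟩ := hc v hv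
  rcases u with t | m | b
  · simp [Gp, hRel] at huv
  · refine ⟨m, hu, ?_⟩
    simpa [Gp, hRel] using huv
  · have := huniq (Sum.inr b) hu
    rw [htop] at this
    cases this
end

section
/- If G has d pairwise disjoint dominating sets, then G' has a clique minor of order n(n+1) + d. -/
/-- If `G` has `d` pairwise disjoint dominating sets, then `G'` has a clique minor of order
`n * (n + 1) + d`. -/
theorem stmt6 (n d : ℕ) (hd : 1 ≤ d) (G : SimpleGraph (Fin n))
    (D : Fin d → Set (Fin n)) (hdom : ∀ i, IsDomSet G (D i))
    (hdisj : ∀ i j, i ≠ j → Disjoint (D i) (D j)) :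
    ∃ S : Fin (n * (n + 1) + d) → Set (HVert n d), IsCliqueMinorFam (Gp n d G) S := by
  classical
  let T : (Fin n × Fin (n + 1)) ⊕ Fin d → Set (HVert n d) := fun x =>
    match x with
    | Sum.inl p => {Sum.inr (Sum.inr p)}
    | Sum.inr i => insert (Sum.inl i) {v | ∃ j ∈ D i, v = Sum.inr (Sum.inl j)}
  let e : Fin (n * (n + 1) + d) ≃ (Fin n × Fin (n + 1)) ⊕ Fin d :=
    finSumFinEquiv.symm.trans (Equiv.sumCongr finProdFinEquiv.symm (Equiv.refl _))
  have hne : ∀ x, (T x).Nonempty := by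
    rintro (p | i)
    · exact ⟨_, rfl⟩
    · exact ⟨Sum.inl i, Set.mem_insert _ _⟩
  have hconn : ∀ x, ((Gp n d G).induce (T x)).Connected := by
    rintro (p | i)
    · have : Subsingleton (T (Sum.inl p)) := Set.subsingleton_coe _ |>.2 Set.subsingleton_singleton
      have : Nonempty (T (Sum.inl p)) := (hne (Sum.inl p)).to_subtype
      exact { preconnected := SimpleGraph.Preconnected.of_subsingleton }
    · rw [SimpleGraph.connected_iff_exists_forall_reachable]
      refine ⟨⟨Sum.inl i, Set.mem_insert _ _⟩, ?_⟩
      rintro ⟨v, rfl | ⟨j, hj, rfl⟩⟩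
      · exact SimpleGraph.Reachable.refl _
      · apply SimpleGraph.Adj.reachable
        simp [Gp, hRel]
  have hdis : ∀ x y, x ≠ y → Disjoint (T x) (T y) := by
    intro x y hxy
    rw [Set.disjoint_left]
    rcases x with p | i <;> rcases y with q | k
    · rintro v rfl h
      apply hxy
      have : (Sum.inr (Sum.inr p) : HVert n d) = Sum.inr (Sum.inr q) := h
      simp_all
    · rintro v rfl (h | ⟨j, -, h⟩) <;> simp at h
    · rintro v (rfl | ⟨j, -, rfl⟩) h
      · exact absurd (show (Sum.inl i : HVert n d) = Sum.inr (Sum.inr q) from h) (by simp)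
      · exact absurd (show (Sum.inr (Sum.inl j) : HVert n d) = Sum.inr (Sum.inr q) from h) (by simp)
    · have hik : i ≠ k := fun h => hxy (by rw [h])
      rintro v (rfl | ⟨j, hj, rfl⟩) (h | ⟨l, hl, h⟩)
      · simp at h; exact hik h
      · simp at h
      · simp at h
      · simp at h
        subst h
        exact Set.disjoint_left.1 (hdisj i k hik) hj hl
  have hmb : ∀ p i, ∃ u ∈ T (Sum.inl p), ∃ v ∈ T (Sum.inr i), (Gp n d G).Adj u v := by
    intro p i
    obtain ⟨j, hj, h⟩ := hdom i p.1
    refine ⟨_, rfl, Sum.inr (Sum.inl j), Or.inr ⟨j, hj, rfl⟩, ?_⟩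
    simpa [Gp, hRel] using h
  have hadj : ∀ x y, x ≠ y → ∃ u ∈ T x, ∃ v ∈ T y, (Gp n d G).Adj u v := by
    intro x y hxy
    rcases x with p | i <;> rcases y with q | k
    · refine ⟨_, rfl, _, rfl, ?_⟩
      have hpq : p ≠ q := fun h => hxy (by rw [h])
      simpa [Gp, hRel] using hpq
    · exact hmb p k
    · obtain ⟨u, hu, v, hv, h⟩ := hmb q i
      exact ⟨v, hv, u, hu, h.symm⟩
    · refine ⟨Sum.inl i, Set.mem_insert _ _, Sum.inl k, Set.mem_insert _ _, ?_⟩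
      have hik : i ≠ k := fun h => hxy (by rw [h])
      simpa [Gp, hRel] using hik
  exact ⟨fun a => T (e a), fun a => hne _, fun a => hconn _,
    fun a b hab => hdis _ _ (e.injective.ne hab), fun a b hab => hadj _ _ (e.injective.ne hab)⟩
end

section
/- Suppose that no vertex of G is adjacent to all of the other n−1 vertices of G. If G' has a clique minor of order n(n+1) + d, then G has d pairwise disjoint dominating sets. -/
/-- Domination: for each `w`, one of the bottom vertices over `w` is a singleton branch set. -/
theorem exists_singleton_bottom (n d : ℕ) (hd : 1 ≤ d) (G : SimpleGraph (Fin n))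
    (hG : ∀ v : Fin n, ∃ w : Fin n, w ≠ v ∧ ¬ G.Adj v w)
    (S : Fin (n * (n + 1) + d) → Set (HVert n d))
    (hS : IsCliqueMinorFam (Gp n d G) S) (w : Fin n) :
    ∃ k i, S i = {Sum.inr (Sum.inr (w, k))} := by
  classical
  obtain ⟨hne, -, hdis, hadj⟩ := hS
  have hn : 2 ≤ n := by
    obtain ⟨u, hu, -⟩ := hG w
    have h1 := u.2
    have h2 := w.2
    have h3 : (u : ℕ) ≠ w := fun h => hu (Fin.ext h)
    omega
  choose r hr using hne
  have hrinj : ∀ i j, r i = r j → i = j := by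
    intro i j hij
    by_contra hne
    exact Set.disjoint_left.1 (hdis i j hne) (hr i) (hij ▸ hr j)
  set A : Finset (Fin (n * (n + 1) + d)) := Finset.univ.filter (fun i => S i = {r i}) with hA
  have hmemA : ∀ i, i ∈ A ↔ S i = {r i} := by intro i; simp [hA]
  have hsum : ∑ i, (S i).toFinset.card ≤ d + (n + n * (n + 1)) := by
    rw [← Finset.card_biUnion]
    · refine (Finset.card_le_univ _).trans ?_
      simp [HVert]
    · intro i _ j _ hij
      exact Set.disjoint_toFinset.2 (hdis i j hij)
  have hlow : ∀ i, 2 ≤ (S i).toFinset.card + (if i ∈ A then 1 else 0) := by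
    intro i
    have hpos : 0 < (S i).toFinset.card := Finset.card_pos.2 ⟨r i, by simpa using hr i⟩
    split_ifs with h
    · omega
    · by_contra hlt
      have h1 : (S i).toFinset.card = 1 := by omega
      obtain ⟨a, ha⟩ := Finset.card_eq_one.1 h1
      apply h
      rw [hmemA]
      have h2 : S i = {a} := by
        have := congrArg (fun s : Finset (HVert n d) => (s : Set (HVert n d))) ha
        simpa using this
      have h3 : r i = a := by
        have := hr i
        rw [h2] at this
        exact this
      rw [h3]; exact h2
  have hAcard : n * n + d ≤ A.card := by
    have h := Finset.sum_le_sum (fun i (_ : i ∈ Finset.univ) => hlow i)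
    rw [Finset.sum_add_distrib] at h
    simp only [Finset.sum_const, Finset.card_univ, Fintype.card_fin, smul_eq_mul,
      Finset.sum_ite_mem, Finset.univ_inter] at h
    nlinarith
  have hAadj : ∀ i ∈ A, ∀ j ∈ A, i ≠ j → (Gp n d G).Adj (r i) (r j) := by
    intro i hi j hj hij
    obtain ⟨u, hu, v, hv, huv⟩ := hadj i j hij
    rw [(hmemA i).1 hi] at hu
    rw [(hmemA j).1 hj] at hv
    rw [Set.mem_singleton_iff] at hu hv
    rw [← hu, ← hv]; exact huv
  -- some bottom singleton
  have hbot : ∃ i ∈ A, ∃ p, r i = Sum.inr (Sum.inr p) := by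
    by_contra hcon
    push Not at hcon
    have hle : A.card ≤ (Finset.univ : Finset (Fin d ⊕ Fin n)).card := by
      apply Finset.card_le_card_of_forall_subsingleton
        (fun i x => r i = Sum.elim Sum.inl (fun m => Sum.inr (Sum.inl m)) x)
      · intro i hi
        rcases h : r i with t | m | p
        · exact ⟨Sum.inl t, by simp, rfl⟩
        · exact ⟨Sum.inr m, by simp, rfl⟩
        · exact absurd h (hcon i hi p)
      · intro x _ i hi j hj
        exact hrinj i j (hi.2.trans hj.2.symm)
    simp at hle
    nlinarith
  obtain ⟨i₀, hi₀, p₀, hp₀⟩ := hbot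
  have htop : ∀ i ∈ A, ∀ t, r i ≠ Sum.inl t := by
    intro i hi t ht
    have hij : i ≠ i₀ := by
      rintro rfl
      rw [ht] at hp₀; cases hp₀
    have := hAadj i hi i₀ hi₀ hij
    rw [ht, hp₀] at this
    simp [Gp, SimpleGraph.fromRel_adj, hRel] at this
  by_contra hcon
  push Not at hcon
  have hle : A.card ≤
      (Finset.insertNone ((Finset.univ.erase w) ×ˢ (Finset.univ : Finset (Fin (n + 1))))).card := by
    apply Finset.card_le_card_of_forall_subsingleton
      (fun i x => match x with
        | none => ∃ m, r i = Sum.inr (Sum.inl m)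
        | some p => r i = Sum.inr (Sum.inr p))
    · intro i hi
      rcases h : r i with t | m | p
      · exact absurd h (htop i hi t)
      · exact ⟨none, by simp, m, rfl⟩
      · refine ⟨some p, ?_, rfl⟩
        have : p.1 ≠ w := by
          rintro rfl
          apply hcon p.2 i
          rw [(hmemA i).1 hi, h]
        simp [this]
    · rintro (_ | p) _ i hi j hj
      · obtain ⟨hiA, m, hm⟩ := hi
        obtain ⟨hjA, m', hm'⟩ := hj
        by_contra hij
        have := hAadj i hiA j hjA hij
        rw [hm, hm'] at this
        simp [Gp, SimpleGraph.fromRel_adj, hRel] at this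
      · exact hrinj i j (hi.2.trans hj.2.symm)
  rw [Finset.card_insertNone, Finset.card_product, Finset.card_erase_of_mem (by simp)] at hle
  simp only [Finset.card_univ, Fintype.card_fin] at hle
  obtain ⟨m, rfl⟩ : ∃ m, n = m + 1 := ⟨n - 1, by omega⟩
  simp only [Nat.add_sub_cancel] at hle
  nlinarith

/-- If no vertex of `G` is adjacent to all others and `G'` has a clique minor of order
`n * (n + 1) + d`, then `G` has `d` pairwise disjoint dominating sets. -/
theorem stmt7 (n d : ℕ) (hd : 1 ≤ d) (G : SimpleGraph (Fin n))
    (hG : ∀ v : Fin n, ∃ w : Fin n, w ≠ v ∧ ¬ G.Adj v w)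
    (S : Fin (n * (n + 1) + d) → Set (HVert n d))
    (hS : IsCliqueMinorFam (Gp n d G) S) :
    ∃ D : Fin d → Set (Fin n),
      (∀ i, IsDomSet G (D i)) ∧ ∀ i j, i ≠ j → Disjoint (D i) (D j) := by
  classical
  have hsing := exists_singleton_bottom n d hd G hG S hS
  obtain ⟨-, -, hdis, hadj⟩ := hS
  set N : Finset (Fin (n * (n + 1) + d)) :=
    Finset.univ.filter (fun i => ∀ p, Sum.inr (Sum.inr p) ∉ S i) with hN
  have hNc : Nᶜ.card ≤ n * (n + 1) := by
    have : Nᶜ.card ≤ (Finset.univ : Finset (Fin n × Fin (n + 1))).card := by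
      apply Finset.card_le_card_of_forall_subsingleton
        (fun i p => (Sum.inr (Sum.inr p) : HVert n d) ∈ S i)
      · intro i hi
        simp only [hN, Finset.mem_compl, Finset.mem_filter, Finset.mem_univ, true_and] at hi
        push Not at hi
        obtain ⟨p, hp⟩ := hi
        exact ⟨p, by simp, hp⟩
      · intro p _ i hi j hj
        by_contra hij
        exact Set.disjoint_left.1 (hdis i j hij) hi.2 hj.2
    simpa using this
  have hcard : d ≤ N.card := by
    have := Finset.card_add_card_compl N
    rw [Fintype.card_fin] at this
    omega
  obtain ⟨e⟩ : Nonempty (Fin d ↪ N) :=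
    Function.Embedding.nonempty_of_card_le (by simpa using hcard)
  refine ⟨fun i => {m | Sum.inr (Sum.inl m) ∈ S (e i)}, ?_, ?_⟩
  · intro i w
    obtain ⟨k, j, hj⟩ := hsing w
    have hi := (e i).2
    simp only [hN, Finset.mem_filter, Finset.mem_univ, true_and] at hi
    have hij : (e i : Fin (n * (n + 1) + d)) ≠ j := by
      intro h
      apply hi (w, k)
      rw [h, hj]; rfl
    obtain ⟨u, hu, v, hv, huv⟩ := hadj _ _ hij
    rw [hj, Set.mem_singleton_iff] at hv
    subst hv
    rcases u with t | m | p
    · simp [Gp, SimpleGraph.fromRel_adj, hRel] at huv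
    · refine ⟨m, hu, ?_⟩
      simpa [Gp, SimpleGraph.fromRel_adj, hRel] using huv
    · exact absurd hu (hi p)
  · intro i j hij
    rw [Set.disjoint_left]
    intro m hm hm'
    have : (e i : Fin (n * (n + 1) + d)) ≠ e j := fun h => hij (e.injective (Subtype.ext h))
    exact Set.disjoint_left.1 (hdis _ _ this) hm hm'
end

section
/- Suppose that no vertex of G is adjacent to all of the other n−1 vertices of G. Then G has d pairwise disjoint dominating sets if and only if G' has a clique minor of order n(n+1) + d. -/
/-- The embedding of top and bottom vertices. -/
def embTB (n d : ℕ) : Fin d ⊕ Fin n × Fin (n + 1) → HVert n d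
  | Sum.inl t => Sum.inl t
  | Sum.inr p => Sum.inr (Sum.inr p)

theorem embTB_inj (n d : ℕ) : Function.Injective (embTB n d) := by
  rintro (a | a) (b | b) h <;> simp_all [embTB]

theorem stmt8_forward (n d : ℕ) (G : SimpleGraph (Fin n)) (D : Fin d → Set (Fin n))
    (hD : ∀ i, IsDomSet G (D i)) (hdis : ∀ i j, i ≠ j → Disjoint (D i) (D j)) :
    ∃ S : Fin (n * (n + 1) + d) → Set (HVert n d), IsCliqueMinorFam (Gp n d G) S := by
  classical
  have hc : Fintype.card (Fin (n * (n + 1) + d))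
      = Fintype.card (Fin d ⊕ Fin n × Fin (n + 1)) := by
    simp [add_comm]
  let e := Fintype.equivOfCardEq hc
  let T : Fin d ⊕ Fin n × Fin (n + 1) → Set (HVert n d) := fun x =>
    match x with
    | Sum.inl t => {v | v = Sum.inl t ∨ ∃ j ∈ D t, v = Sum.inr (Sum.inl j)}
    | Sum.inr p => {Sum.inr (Sum.inr p)}
  have hmem : ∀ x, embTB n d x ∈ T x := by
    rintro (t | p) <;> simp [T, embTB]
  have hconn : ∀ x, ((Gp n d G).induce (T x)).Connected := by
    intro x
    have : ∀ y : T x, ((Gp n d G).induce (T x)).Reachable ⟨_, hmem x⟩ y := by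
      rintro ⟨y, hy⟩
      by_cases hxy : embTB n d x = y
      · subst hxy
        exact SimpleGraph.Reachable.refl _
      · apply SimpleGraph.Adj.reachable
        rcases x with t | p
        · rcases hy with rfl | ⟨j, hj, rfl⟩
          · simp [embTB] at hxy
          · simp [Gp, hRel, embTB]
        · simp [T, embTB] at hy hxy
          exact absurd hy.symm hxy
    have hnon : Nonempty (T x) := ⟨⟨_, hmem x⟩⟩
    exact ⟨fun a b => (this a).symm.trans (this b)⟩
  have hdisj : ∀ x y, x ≠ y → Disjoint (T x) (T y) := by
    intro x y hxy
    rw [Set.disjoint_left]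
    intro v hv hw
    rcases x with t | p <;> rcases y with s | q
    · have hts : t ≠ s := by rintro rfl; exact hxy rfl
      rcases hv with rfl | ⟨j, hj, rfl⟩
      · rcases hw with h | ⟨k, hk, h⟩
        · simp at h; exact hts h
        · simp at h
      · rcases hw with h | ⟨k, hk, h⟩
        · simp at h
        · simp at h
          subst h
          exact Set.disjoint_left.mp (hdis t s hts) hj hk
    · simp [T] at hv hw
      subst hw
      simp at hv
    · simp [T] at hv hw
      subst hv
      simp at hw
    · simp [T] at hv hw
      subst hv
      simp at hw
      exact hxy (by rw [hw])
  have htb : ∀ t p, ∃ u ∈ T (Sum.inl t), ∃ v ∈ T (Sum.inr p), (Gp n d G).Adj u v := by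
    intro t p
    obtain ⟨v, hv, h⟩ := hD t p.1
    exact ⟨Sum.inr (Sum.inl v), Or.inr ⟨v, hv, rfl⟩, Sum.inr (Sum.inr p), rfl,
      by simpa [Gp, hRel] using h⟩
  have hadj : ∀ x y, x ≠ y → ∃ u ∈ T x, ∃ v ∈ T y, (Gp n d G).Adj u v := by
    intro x y hxy
    rcases x with t | p <;> rcases y with s | q
    · exact ⟨_, hmem (Sum.inl t), _, hmem (Sum.inl s), by simpa [Gp, hRel, embTB] using hxy⟩
    · exact htb t q
    · obtain ⟨u, hu, v, hv, h⟩ := htb s p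
      exact ⟨v, hv, u, hu, h.symm⟩
    · exact ⟨_, hmem (Sum.inr p), _, hmem (Sum.inr q), by simpa [Gp, hRel, embTB] using hxy⟩
  exact ⟨fun i => T (e i), fun i => ⟨_, hmem _⟩, fun i => hconn _,
    fun i j h => hdisj _ _ (fun h' => h (e.injective h')),
    fun i j h => hadj _ _ (fun h' => h (e.injective h'))⟩

/-- In a connected induced subgraph, each vertex of a nontrivial set has a neighbour in it. -/
theorem exists_adj_of_conn {V : Type*} (H : SimpleGraph V) (A : Set V)
    (hA : (H.induce A).Connected) {a b : V} (ha : a ∈ A) (hb : b ∈ A) (hab : a ≠ b) :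
    ∃ c ∈ A, H.Adj a c := by
  have : Nontrivial A := ⟨⟨a, ha⟩, ⟨b, hb⟩, by simpa using hab⟩
  obtain ⟨c, hc⟩ := hA.preconnected.exists_adj_of_nontrivial ⟨a, ha⟩
  exact ⟨c.1, c.2, hc⟩

theorem stmt8_backward (n d : ℕ) (G : SimpleGraph (Fin n))
    (hG : ∀ v : Fin n, ∃ w : Fin n, w ≠ v ∧ ¬ G.Adj v w)
    (S : Fin (n * (n + 1) + d) → Set (HVert n d)) (hS : IsCliqueMinorFam (Gp n d G) S) :
    ∃ D : Fin d → Set (Fin n),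
        (∀ i, IsDomSet G (D i)) ∧ ∀ i j, i ≠ j → Disjoint (D i) (D j) := by
  classical
  obtain ⟨hne, hconn, hdis, hadj⟩ := hS
  have huniq : ∀ i j v, v ∈ S i → v ∈ S j → i = j := by
    intro i j v hi hj
    by_contra h
    exact Set.disjoint_left.mp (hdis i j h) hi hj
  -- no branch set is a single middle vertex
  have hsing : ∀ i j, S i ≠ {Sum.inr (Sum.inl j)} := by
    intro i j hij
    obtain ⟨w, hwj, hw⟩ := hG j
    have h1 : ∀ k : {k // k ≠ i}, ∃ x : Fin d ⊕ {w' : Fin n // w' ≠ w} × Fin (n + 1),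
        embTB n d (Sum.map id (Prod.map Subtype.val id) x) ∈ S k := by
      rintro ⟨k, hk⟩
      obtain ⟨u, hu, v, hv, h⟩ := hadj i k hk.symm
      rw [hij] at hu
      obtain rfl : u = _ := hu
      rcases v with t | m | p
      · exact ⟨Sum.inl t, hv⟩
      · simp [Gp, hRel] at h
      · have h2 : j = p.1 ∨ G.Adj j p.1 := by simpa [Gp, hRel] using h
        refine ⟨Sum.inr (⟨p.1, ?_⟩, p.2), hv⟩
        rintro rfl
        rcases h2 with h2 | h2
        · exact hwj h2.symm
        · exact hw h2
    choose g hg using h1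
    have ginj : Function.Injective g := by
      intro a b hab
      have ha := hg a
      rw [hab] at ha
      exact Subtype.ext (huniq _ _ _ ha (hg b))
    have hcard := Fintype.card_le_of_injective g ginj
    simp [Fintype.card_subtype_compl] at hcard
    have hn : 0 < n := w.pos
    obtain ⟨m, rfl⟩ : ∃ m, n = m + 1 := ⟨n - 1, by omega⟩
    simp only [Nat.add_sub_cancel] at hcard
    ring_nf at hcard
    omega
  have h1 : ∀ i, ∃ x, embTB n d x ∈ S i := by
    intro i
    obtain ⟨v, hv⟩ := hne i
    rcases v with t | m | p
    · exact ⟨Sum.inl t, hv⟩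
    · have : ∃ b ∈ S i, (Sum.inr (Sum.inl m) : HVert n d) ≠ b := by
        by_contra hcon
        push Not at hcon
        apply hsing i m
        ext b
        exact ⟨fun hb => (hcon b hb).symm, fun hb => by rw [hb]; exact hv⟩
      obtain ⟨b, hb, hmb⟩ := this
      obtain ⟨c, hc, h⟩ := exists_adj_of_conn _ _ (hconn i) hv hb hmb
      rcases c with t | m | p
      · exact ⟨Sum.inl t, hc⟩
      · simp [Gp, hRel] at h
      · exact ⟨Sum.inr p, hc⟩
    · exact ⟨Sum.inr p, hv⟩
  choose f hf using h1
  have finj : Function.Injective f := by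
    intro a b hab
    have ha := hf a
    rw [hab] at ha
    exact huniq _ _ _ ha (hf b)
  have fbij : Function.Bijective f := by
    rw [Fintype.bijective_iff_injective_and_card]
    exact ⟨finj, by simp [add_comm]⟩
  have honly : ∀ i x, embTB n d x ∈ S i → x = f i := by
    intro i x hx
    obtain ⟨k, rfl⟩ := fbij.2 x
    rw [huniq _ _ _ hx (hf k)]
  choose g hg using fbij.2
  have hgm : ∀ x, embTB n d x ∈ S (g x) := by
    intro x
    have := hf (g x)
    rwa [hg] at this
  have hrow : ∀ w : Fin n, ∃ k : Fin (n + 1), ∀ v ∈ S (g (Sum.inr (w, k))),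
      v = Sum.inr (Sum.inr (w, k)) := by
    intro w
    by_contra hcon
    push Not at hcon
    have : ∀ k : Fin (n + 1), ∃ m : Fin n, Sum.inr (Sum.inl m) ∈ S (g (Sum.inr (w, k))) := by
      intro k
      obtain ⟨v, hv, hvne⟩ := hcon k
      rcases v with t | m | p
      · have := honly _ (Sum.inl t) hv
        rw [hg] at this
        cases this
      · exact ⟨m, hv⟩
      · have := honly _ (Sum.inr p) hv
        rw [hg] at this
        cases this
        exact absurd rfl hvne
    choose m hm using this
    have minj : Function.Injective m := by
      intro a b hab
      have ha := hm a
      rw [hab] at ha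
      have h2 := congrArg f (huniq _ _ _ ha (hm b))
      rw [hg, hg] at h2
      simpa using h2
    have := Fintype.card_le_of_injective m minj
    simp at this
  refine ⟨fun t => {v | Sum.inr (Sum.inl v) ∈ S (g (Sum.inl t))}, ?_, ?_⟩
  · intro t w
    obtain ⟨k, hk⟩ := hrow w
    have hne' : g (Sum.inl t) ≠ g (Sum.inr (w, k)) := by
      intro h
      have h2 := congrArg f h
      rw [hg, hg] at h2
      cases h2
    obtain ⟨u, hu, v, hv, h⟩ := hadj _ _ hne'
    rw [hk v hv] at h
    rcases u with s | m | p
    · simp [Gp, hRel] at h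
    · exact ⟨m, hu, by simpa [Gp, hRel] using h⟩
    · have := honly _ (Sum.inr p) hu
      rw [hg] at this
      cases this
  · intro s t hst
    rw [Set.disjoint_left]
    intro v hv hw
    have h2 := congrArg f (huniq _ _ _ hv hw)
    rw [hg, hg] at h2
    exact hst (by simpa using h2)

/-- If no vertex of `G` is adjacent to all others, then `G` has `d` pairwise disjoint
dominating sets if and only if `G'` has a clique minor of order `n * (n + 1) + d`. -/
theorem stmt8 (n d : ℕ) (hd : 1 ≤ d) (G : SimpleGraph (Fin n))
    (hG : ∀ v : Fin n, ∃ w : Fin n, w ≠ v ∧ ¬ G.Adj v w) :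
    (∃ D : Fin d → Set (Fin n),
        (∀ i, IsDomSet G (D i)) ∧ ∀ i j, i ≠ j → Disjoint (D i) (D j)) ↔
      (∃ S : Fin (n * (n + 1) + d) → Set (HVert n d), IsCliqueMinorFam (Gp n d G) S) := by
  constructor
  · rintro ⟨D, hD, hdis⟩
    exact stmt8_forward n d G D hD hdis
  · rintro ⟨S, hS⟩
    exact stmt8_backward n d G hG S hS
end

section
/- If there exist k pairwise vertex-disjoint paths P_1, …, P_k in G such that P_i has endpoints s_i and t_i, then G' has a clique minor of order n + 1. -/
/-- A vertex of `G` is a terminal: one of the `s i` or `t i`. -/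
def IsTerminal {V : Type*} {k : ℕ} (s t : Fin k → V) (v : V) : Prop :=
  (∃ i, v = s i) ∨ (∃ i, v = t i)

/-- Generating relation for the edges of `G'` in the disjoint-paths reduction: all edges of
`G`; all pairs of distinct new vertices (the set `W`, modelled by `Fin m`); all pairs of a
new vertex and a terminal; and all pairs of distinct terminals except the pairs `{s i, t i}`. -/
def dpRel {V : Type*} {k : ℕ} (G : SimpleGraph V) (s t : Fin k → V) (m : ℕ) :
    (V ⊕ Fin m) → (V ⊕ Fin m) → Prop
  | Sum.inl u, Sum.inl w => G.Adj u w ∨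
      (IsTerminal s t u ∧ IsTerminal s t w ∧
        ¬ ∃ i, (u = s i ∧ w = t i) ∨ (u = t i ∧ w = s i))
  | Sum.inl u, Sum.inr _ => IsTerminal s t u
  | Sum.inr _, Sum.inr _ => True
  | Sum.inr _, Sum.inl _ => False

/-- The graph `G'` of the disjoint-paths reduction: `G` together with an `(n+1)`-clique on
`W ∪ {terminals}` from which the `k` edges `s i t i` have been removed. -/
def Gdp {V : Type*} {k : ℕ} (G : SimpleGraph V) (s t : Fin k → V) (m : ℕ) :
    SimpleGraph (V ⊕ Fin m) :=
  SimpleGraph.fromRel (dpRel G s t m)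

/-- The `n + 1` vertices `Q = W ∪ {s_1, t_1, …, s_k, t_k}` spanning the clique part. -/
def cliquePart {V : Type*} {k : ℕ} (s t : Fin k → V) (m : ℕ) : Set (V ⊕ Fin m) :=
  {x | (∃ w : Fin m, x = Sum.inr w) ∨ ∃ u : V, x = Sum.inl u ∧ IsTerminal s t u}

/-- The inclusion of the graph into its extension. -/
def dpHom {V : Type*} {k : ℕ} (G : SimpleGraph V) (s t : Fin k → V) (m : ℕ) :
    G →g Gdp G s t m where
  toFun := Sum.inl
  map_rel' := by
    intro a b h
    refine (SimpleGraph.fromRel_adj _ _ _).2 ⟨fun e => h.ne (Sum.inl.inj e), Or.inl (Or.inl h)⟩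

/-- The branch sets of the clique minor. -/
def dpBranch {V : Type*} {k : ℕ} (G : SimpleGraph V) (s t : Fin k → V) (m : ℕ)
    (P : ∀ i : Fin k, G.Walk (s i) (t i)) : (Fin k ⊕ Fin k) ⊕ Fin m → Set (V ⊕ Fin m)
  | Sum.inl (Sum.inl i) => {Sum.inl (s i)}
  | Sum.inl (Sum.inr i) => {x | x ∈ ((P i).tail.map (dpHom G s t m)).support}
  | Sum.inr w => {Sum.inr w}

theorem dp_singleton_connected {V : Type*} (H : SimpleGraph V) (v : V) :
    (H.induce {v}).Connected := by
  have : Nonempty ({v} : Set V) := ⟨⟨v, rfl⟩⟩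
  refine SimpleGraph.Connected.mk ?_
  intro a b
  rw [Subsingleton.elim a b]

theorem dpBranch_main {V : Type*} {k : ℕ} (G : SimpleGraph V) (s t : Fin k → V) (m : ℕ)
    (hdist : Function.Injective (Sum.elim s t))
    (P : ∀ i : Fin k, G.Walk (s i) (t i)) (hP : ∀ i, (P i).IsPath)
    (hPdisj : ∀ i j, i ≠ j → ∀ v, v ∈ (P i).support → v ∉ (P j).support) :
    (∀ x, (dpBranch G s t m P x).Nonempty) ∧
    (∀ x, ((Gdp G s t m).induce (dpBranch G s t m P x)).Connected) ∧
    (∀ x y, x ≠ y → Disjoint (dpBranch G s t m P x) (dpBranch G s t m P y)) ∧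
    (∀ x y, x ≠ y → ∃ u ∈ dpBranch G s t m P x, ∃ v ∈ dpBranch G s t m P y,
      (Gdp G s t m).Adj u v) := by
  have hst : ∀ i j, s i ≠ t j := fun i j h => by
    have := @hdist (Sum.inl i) (Sum.inr j) h
    simp at this
  have hs : ∀ i j, s i = s j → i = j := fun i j h => by
    have := @hdist (Sum.inl i) (Sum.inl j) h
    simpa using this
  have ht : ∀ i j, t i = t j → i = j := fun i j h => by
    have := @hdist (Sum.inr i) (Sum.inr j) h
    simpa using this
  have hnil : ∀ i, ¬ (P i).Nil := fun i => SimpleGraph.Walk.not_nil_of_ne (hst i i)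
  have hsup : ∀ i, (P i).support = s i :: (P i).tail.support := fun i => by
    rw [SimpleGraph.Walk.support_tail_of_not_nil _ (hnil i)]
    exact (SimpleGraph.Walk.cons_tail_support _).symm
  have hsn : ∀ i, s i ∉ (P i).tail.support := fun i => by
    have := (hP i).support_nodup
    rw [hsup i] at this
    exact (List.nodup_cons.1 this).1
  have hsub : ∀ i v, v ∈ (P i).tail.support → v ∈ (P i).support := fun i v h => by
    rw [hsup i]; exact List.mem_cons_of_mem _ h
  have hmem : ∀ i x, x ∈ dpBranch G s t m P (Sum.inl (Sum.inr i)) ↔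
      ∃ v ∈ (P i).tail.support, Sum.inl v = x := fun i x => by
    simp only [dpBranch, SimpleGraph.Walk.support_map, Set.mem_ofPred_eq, List.mem_map]
    rfl
  have htm : ∀ i, Sum.inl (t i) ∈ dpBranch G s t m P (Sum.inl (Sum.inr i)) := fun i =>
    (hmem i _).2 ⟨t i, SimpleGraph.Walk.end_mem_support _, rfl⟩
  have hadj1 : ∀ i, ∃ v ∈ dpBranch G s t m P (Sum.inl (Sum.inr i)),
      (Gdp G s t m).Adj (Sum.inl (s i)) v := fun i =>
    ⟨Sum.inl (P i).snd, (hmem i _).2 ⟨_, SimpleGraph.Walk.start_mem_support _, rfl⟩,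
      (dpHom G s t m).map_adj ((P i).adj_snd (hnil i))⟩
  have hTs : ∀ i, IsTerminal s t (s i) := fun i => Or.inl ⟨i, rfl⟩
  have hTt : ∀ i, IsTerminal s t (t i) := fun i => Or.inr ⟨i, rfl⟩
  have hadjT : ∀ u w, IsTerminal s t u → IsTerminal s t w → u ≠ w →
      (¬ ∃ i, (u = s i ∧ w = t i) ∨ (u = t i ∧ w = s i)) →
      (Gdp G s t m).Adj (Sum.inl u) (Sum.inl w) := fun u w hu hw hne h =>
    (SimpleGraph.fromRel_adj _ _ _).2
      ⟨fun e => hne (Sum.inl.inj e), Or.inl (Or.inr ⟨hu, hw, h⟩)⟩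
  have hadjW : ∀ u (w : Fin m), IsTerminal s t u →
      (Gdp G s t m).Adj (Sum.inl u) (Sum.inr w) := fun u w hu =>
    (SimpleGraph.fromRel_adj _ _ _).2 ⟨by simp, Or.inl hu⟩
  refine ⟨?_, ?_, ?_, ?_⟩
  · rintro ((i | i) | w)
    · exact ⟨_, rfl⟩
    · exact ⟨_, htm i⟩
    · exact ⟨_, rfl⟩
  · rintro ((i | i) | w)
    · exact dp_singleton_connected _ _
    · exact SimpleGraph.Walk.connected_induce_support _
    · exact dp_singleton_connected _ _
  · intro x y hxy
    rw [Set.disjoint_left]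
    intro z hx hy
    rcases x with ((i | i) | w) <;> rcases y with ((j | j) | w') <;>
      (try simp only [hmem] at hx hy) <;>
      (try simp only [dpBranch, Set.mem_singleton_iff] at hx hy)
    · subst hx
      exact hxy (by rw [hs i j (Sum.inl.inj hy)])
    · subst hx
      obtain ⟨v, hv, e⟩ := hy
      obtain rfl := Sum.inl.inj e
      by_cases hij : i = j
      · subst hij; exact hsn i hv
      · exact hPdisj i j hij _ (SimpleGraph.Walk.start_mem_support _) (hsub j _ hv)
    · subst hx; simp at hy
    · subst hy
      obtain ⟨v, hv, e⟩ := hx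
      obtain rfl := Sum.inl.inj e
      by_cases hij : i = j
      · subst hij; exact hsn i hv
      · exact hPdisj i j hij _ (hsub i _ hv) (SimpleGraph.Walk.start_mem_support _)
    · obtain ⟨v, hv, e⟩ := hx
      obtain ⟨v', hv', e'⟩ := hy
      obtain rfl := Sum.inl.inj (e.trans e'.symm)
      have hij : i ≠ j := fun h => hxy (by rw [h])
      exact hPdisj i j hij _ (hsub i _ hv) (hsub j _ hv')
    · subst hy; simp at hx
    · subst hx; simp at hy
    · subst hx; simp at hy
    · subst hx
      exact hxy (by rw [Sum.inr.inj hy])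
  · rintro ((i | i) | w) ((j | j) | w') hxy
    · have hij : i ≠ j := fun h => hxy (by rw [h])
      refine ⟨_, rfl, _, rfl, hadjT _ _ (hTs i) (hTs j) (fun h => hij (hs _ _ h)) ?_⟩
      rintro ⟨l, ⟨_, h⟩ | ⟨h, _⟩⟩ <;> exact hst _ _ h
    · by_cases hij : i = j
      · subst hij
        obtain ⟨v, hv, h⟩ := hadj1 i
        exact ⟨_, rfl, v, hv, h⟩
      · refine ⟨_, rfl, _, htm j, hadjT _ _ (hTs i) (hTt j) (hst i j) ?_⟩
        rintro ⟨l, ⟨h, h'⟩ | ⟨h, _⟩⟩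
        · exact hij ((hs _ _ h).trans (ht _ _ h').symm)
        · exact hst _ _ h
    · exact ⟨_, rfl, _, rfl, hadjW _ _ (hTs i)⟩
    · by_cases hij : i = j
      · subst hij
        obtain ⟨v, hv, h⟩ := hadj1 i
        exact ⟨v, hv, _, rfl, h.symm⟩
      · refine ⟨_, htm i, _, rfl, hadjT _ _ (hTt i) (hTs j) (hst j i).symm ?_⟩
        rintro ⟨l, ⟨h, _⟩ | ⟨h, h'⟩⟩
        · exact hst _ _ h.symm
        · exact hij ((ht _ _ h).trans (hs _ _ h').symm)
    · have hij : i ≠ j := fun h => hxy (by rw [h])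
      refine ⟨_, htm i, _, htm j, hadjT _ _ (hTt i) (hTt j) (fun h => hij (ht _ _ h)) ?_⟩
      rintro ⟨l, ⟨h, _⟩ | ⟨_, h⟩⟩ <;> exact hst _ _ h.symm
    · exact ⟨_, htm i, _, rfl, hadjW _ _ (hTt i)⟩
    · exact ⟨_, rfl, _, rfl, (hadjW _ _ (hTs j)).symm⟩
    · exact ⟨_, rfl, _, htm j, (hadjW _ _ (hTt j)).symm⟩
    · have hij : w ≠ w' := fun h => hxy (by rw [h])
      exact ⟨_, rfl, _, rfl, (SimpleGraph.fromRel_adj _ _ _).2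
        ⟨fun e => hij (Sum.inr.inj e), Or.inl trivial⟩⟩

/-- If `G` contains `k` pairwise vertex-disjoint paths joining `s i` to `t i`, then `G'` has
a clique minor of order `n + 1`, where `n` is the number of vertices of `G`. -/
theorem stmt10 {V : Type*} [Fintype V] (G : SimpleGraph V) (k : ℕ) (s t : Fin k → V)
    (hdist : Function.Injective (Sum.elim s t))
    (hk : 2 * k ≤ Fintype.card V + 1)
    (P : ∀ i : Fin k, G.Walk (s i) (t i)) (hP : ∀ i, (P i).IsPath)
    (hPdisj : ∀ i j, i ≠ j → ∀ v, v ∈ (P i).support → v ∉ (P j).support) :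
    ∃ S : Fin (Fintype.card V + 1) → Set (V ⊕ Fin (Fintype.card V + 1 - 2 * k)),
      IsCliqueMinorFam (Gdp G s t (Fintype.card V + 1 - 2 * k)) S := by
  obtain ⟨h1, h2, h3, h4⟩ := dpBranch_main G s t (Fintype.card V + 1 - 2 * k) hdist P hP hPdisj
  have e : Fin (Fintype.card V + 1) ≃ (Fin k ⊕ Fin k) ⊕ Fin (Fintype.card V + 1 - 2 * k) :=
    Fintype.equivOfCardEq (by simp; omega)
  exact ⟨fun i => dpBranch G s t _ P (e i), fun i => h1 _, fun i => h2 _,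
    fun i j hij => h3 _ _ (e.injective.ne hij), fun i j hij => h4 _ _ (e.injective.ne hij)⟩
end

section
/- Let Q = W ∪ {s_1, t_1, …, s_k, t_k} be the n + 1 vertices of G' spanning the clique part of the construction. Every nonempty set A of vertices of G' that is disjoint from Q has at most n − 1 neighbors outside A; consequently, if S_1, …, S_{n+1} is a clique minor of order n + 1 in G', then each set S_i contains exactly one vertex of Q. -/
theorem dp_nbr_inl {V : Type*} {k : ℕ} (G : SimpleGraph V) (s t : Fin k → V) (m : ℕ)
    (a x : V ⊕ Fin m) (ha : a ∉ cliquePart s t m) (h : (Gdp G s t m).Adj a x) :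
    ∃ v, x = Sum.inl v := by
  rcases x with v | w
  · exact ⟨v, rfl⟩
  · exfalso
    apply ha
    rcases a with u | w'
    · right
      refine ⟨u, rfl, ?_⟩
      simpa [Gdp, SimpleGraph.fromRel_adj, dpRel] using h
    · exact Or.inl ⟨w', rfl⟩

theorem dp_first {V : Type*} [Fintype V] {k : ℕ} (G : SimpleGraph V) (s t : Fin k → V) (m : ℕ)
    (A : Set (V ⊕ Fin m)) (hA : A.Nonempty) (hd : Disjoint A (cliquePart s t m)) :
    {x | x ∉ A ∧ ∃ a ∈ A, (Gdp G s t m).Adj a x}.ncard + 1 ≤ Fintype.card V := by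
  classical
  obtain ⟨a, ha⟩ := hA
  have hQ : ∀ b ∈ A, b ∉ cliquePart s t m := fun b hb => Set.disjoint_left.mp hd hb
  have hna : a ∉ {x | x ∉ A ∧ ∃ a ∈ A, (Gdp G s t m).Adj a x} := fun h => h.1 ha
  rw [← Set.ncard_insert_of_notMem hna (Set.toFinite _)]
  have hsub : insert a {x | x ∉ A ∧ ∃ a ∈ A, (Gdp G s t m).Adj a x} ⊆
      (Sum.inl : V → V ⊕ Fin m) '' Set.univ := by
    intro x hx
    rcases hx with rfl | ⟨-, b, hb, hbx⟩
    · rcases x with u | w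
      · exact ⟨u, trivial, rfl⟩
      · exact absurd (Or.inl ⟨w, rfl⟩) (hQ _ ha)
    · obtain ⟨v, rfl⟩ := dp_nbr_inl G s t m b x (hQ b hb) hbx
      exact ⟨v, trivial, rfl⟩
  refine (Set.ncard_le_ncard hsub (Set.toFinite _)).trans ?_
  refine (Set.ncard_image_le (Set.toFinite _)).trans ?_
  simp [Set.ncard_univ]

/-- Every nonempty vertex set `A` of `G'` disjoint from the clique part `Q` has at most
`n - 1` neighbors outside `A`; consequently, each set of a clique minor of order `n + 1`
in `G'` contains exactly one vertex of `Q`. -/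
theorem stmt11 {V : Type*} [Fintype V] (G : SimpleGraph V) (k : ℕ) (s t : Fin k → V)
    (hdist : Function.Injective (Sum.elim s t))
    (hk : 2 * k ≤ Fintype.card V + 1) :
    (∀ A : Set (V ⊕ Fin (Fintype.card V + 1 - 2 * k)), A.Nonempty →
        Disjoint A (cliquePart s t (Fintype.card V + 1 - 2 * k)) →
        {x | x ∉ A ∧ ∃ a ∈ A, (Gdp G s t (Fintype.card V + 1 - 2 * k)).Adj a x}.ncard ≤
          Fintype.card V - 1) ∧
      ∀ S : Fin (Fintype.card V + 1) → Set (V ⊕ Fin (Fintype.card V + 1 - 2 * k)),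
        IsCliqueMinorFam (Gdp G s t (Fintype.card V + 1 - 2 * k)) S →
        ∀ i, ∃! q, q ∈ cliquePart s t (Fintype.card V + 1 - 2 * k) ∧ q ∈ S i := by
  classical
  refine ⟨fun A hA hd => Nat.le_sub_one_of_lt (dp_first G s t _ A hA hd), ?_⟩
  generalize hm : Fintype.card V + 1 - 2 * k = m
  intro S ⟨hne, _, hdis, hadj⟩
  have hmeet : ∀ i, ∃ q, q ∈ cliquePart s t m ∧ q ∈ S i := by
    intro i
    by_contra hcon
    have hd : Disjoint (S i) (cliquePart s t m) :=
      Set.disjoint_left.mpr fun x hx hq => hcon ⟨x, hq, hx⟩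
    have h1 := dp_first G s t m (S i) (hne i) hd
    have h2 : ∀ j : {j // j ≠ i}, ∃ v, v ∈ S j ∧ ∃ u ∈ S i, (Gdp G s t m).Adj u v := by
      intro j
      obtain ⟨u, hu, v, hv, huv⟩ := hadj i j (Ne.symm j.2)
      exact ⟨v, hv, u, hu, huv⟩
    choose f hf hf' using h2
    have hinj : Function.Injective f := by
      intro j j' e
      by_contra hne'
      have := hdis j j' (fun h => hne' (Subtype.ext h))
      exact Set.disjoint_left.mp this (hf j) (e ▸ hf j')
    have hsub : Set.range f ⊆ {x | x ∉ S i ∧ ∃ a ∈ S i, (Gdp G s t m).Adj a x} := by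
      rintro _ ⟨j, rfl⟩
      exact ⟨Set.disjoint_left.mp (hdis j i j.2) (hf j), hf' j⟩
    have h3 := Set.ncard_le_ncard hsub (Set.toFinite _)
    rw [← Set.image_univ, Set.ncard_image_of_injective _ hinj, Set.ncard_univ,
      Nat.card_eq_fintype_card, Fintype.card_subtype_compl] at h3
    rw [Fintype.card_fin, Fintype.card_subtype_eq] at h3
    omega
  let F : (Fin k ⊕ Fin k) ⊕ Fin m → V ⊕ Fin m := Sum.map (Sum.elim s t) id
  have hF : ∀ q ∈ cliquePart s t m, ∃ p, F p = q := by
    rintro q (⟨w, rfl⟩ | ⟨u, rfl, ⟨i, rfl⟩ | ⟨i, rfl⟩⟩)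
    · exact ⟨Sum.inr w, rfl⟩
    · exact ⟨Sum.inl (Sum.inl i), rfl⟩
    · exact ⟨Sum.inl (Sum.inr i), rfl⟩
  have hP : ∀ i, ∃ p, F p ∈ S i := by
    intro i
    obtain ⟨q, hq, hqi⟩ := hmeet i
    obtain ⟨p, rfl⟩ := hF q hq
    exact ⟨p, hqi⟩
  choose p hp using hP
  have hpinj : Function.Injective p := by
    intro i j e
    by_contra hij
    exact Set.disjoint_left.mp (hdis i j hij) (hp i) (e ▸ hp j)
  have hbij : Function.Bijective p := by
    rw [Fintype.bijective_iff_injective_and_card]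
    refine ⟨hpinj, ?_⟩
    simp
    omega
  have key : ∀ i q, q ∈ cliquePart s t m → q ∈ S i → q = F (p i) := by
    intro i q hq hqi
    obtain ⟨r, rfl⟩ := hF q hq
    obtain ⟨j, rfl⟩ := hbij.2 r
    by_cases hij : j = i
    · rw [hij]
    · exact absurd hqi (Set.disjoint_left.mp (hdis j i hij) (hp j))
  intro i
  obtain ⟨q, hq, hqi⟩ := hmeet i
  exact ⟨q, ⟨hq, hqi⟩, fun q' h => (key i q' h.1 h.2).trans (key i q hq hqi).symm⟩
end

section
/- If G' has a clique minor of order n + 1, then there exist k pairwise vertex-disjoint paths P_1, …, P_k in G such that P_i has endpoints s_i and t_i. -/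
theorem Gdp_inl_adj {V : Type*} {k : ℕ} (G : SimpleGraph V) (s t : Fin k → V) (m : ℕ)
    (u v : V) (h : (Gdp G s t m).Adj (Sum.inl u) (Sum.inl v)) :
    u ≠ v ∧ (G.Adj u v ∨ (IsTerminal s t u ∧ IsTerminal s t v ∧
        ¬ ∃ i, (u = s i ∧ v = t i) ∨ (u = t i ∧ v = s i))) := by
  rw [Gdp, SimpleGraph.fromRel_adj] at h
  obtain ⟨h1, h2⟩ := h
  refine ⟨fun e => h1 (by rw [e]), ?_⟩
  rcases h2 with (h | ⟨a, b, c⟩) | (h | ⟨a, b, c⟩)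
  · exact Or.inl h
  · exact Or.inr ⟨a, b, c⟩
  · exact Or.inl h.symm
  · refine Or.inr ⟨b, a, ?_⟩
    rintro ⟨i, h | h⟩
    · exact c ⟨i, Or.inr ⟨h.2, h.1⟩⟩
    · exact c ⟨i, Or.inl ⟨h.2, h.1⟩⟩

theorem Gdp_inr_adj {V : Type*} {k : ℕ} (G : SimpleGraph V) (s t : Fin k → V) (m : ℕ)
    (u : V) (w : Fin m) (h : (Gdp G s t m).Adj (Sum.inl u) (Sum.inr w)) :
    IsTerminal s t u := by
  rw [Gdp, SimpleGraph.fromRel_adj] at h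
  rcases h.2 with h | h
  · exact h
  · exact h.elim

/-- Parametrization of the clique part. -/
def cliqueEmb {V : Type*} {k : ℕ} (s t : Fin k → V) (m : ℕ) :
    (Fin k ⊕ Fin k) ⊕ Fin m → V ⊕ Fin m
  | Sum.inl (Sum.inl i) => Sum.inl (s i)
  | Sum.inl (Sum.inr i) => Sum.inl (t i)
  | Sum.inr w => Sum.inr w

/-- If `G'` has a clique minor of order `n + 1`, then `G` contains `k` pairwise
vertex-disjoint paths joining `s i` to `t i`. -/
theorem stmt12 {V : Type*} [Fintype V] (G : SimpleGraph V) (k : ℕ) (s t : Fin k → V)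
    (hdist : Function.Injective (Sum.elim s t))
    (hk : 2 * k ≤ Fintype.card V + 1)
    (S : Fin (Fintype.card V + 1) → Set (V ⊕ Fin (Fintype.card V + 1 - 2 * k)))
    (hS : IsCliqueMinorFam (Gdp G s t (Fintype.card V + 1 - 2 * k)) S) :
    ∃ P : ∀ i : Fin k, G.Walk (s i) (t i),
      (∀ i, (P i).IsPath) ∧
        ∀ i j, i ≠ j → ∀ v, v ∈ (P i).support → v ∉ (P j).support := by
  classical
  obtain ⟨hne, hconn, hdisj, hadj⟩ := hS
  have huniq : ∀ i j x, x ∈ S i → x ∈ S j → i = j := by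
    intro i j x hi hj
    by_contra hij
    exact Set.disjoint_left.1 (hdisj i j hij) hi hj
  -- every branch set meets the clique part
  have hQ : ∀ j, ∃ x, cliqueEmb s t (Fintype.card V + 1 - 2 * k) x ∈ S j := by
    intro j
    by_contra hcon
    push Not at hcon
    have hA : ∀ x ∈ S j, ∃ v, x = Sum.inl v ∧ ¬ IsTerminal s t v := by
      rintro (v | w) hx
      · refine ⟨v, rfl, ?_⟩
        rintro (⟨i, rfl⟩ | ⟨i, rfl⟩)
        · exact hcon (Sum.inl (Sum.inl i)) hx
        · exact hcon (Sum.inl (Sum.inr i)) hx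
      · exact (hcon (Sum.inr w) hx).elim
    have hV : ∀ l, ∃ v : V, Sum.inl v ∈ S l := by
      intro l
      by_cases hl : j = l
      · subst hl
        obtain ⟨x, hx⟩ := hne j
        obtain ⟨v, rfl, -⟩ := hA x hx
        exact ⟨v, hx⟩
      · obtain ⟨x, hx, y, hy, hxy⟩ := hadj j l hl
        obtain ⟨v, rfl, hv⟩ := hA x hx
        rcases y with y | w
        · exact ⟨y, hy⟩
        · exact (hv (Gdp_inr_adj _ _ _ _ _ _ hxy)).elim
    choose f hf using hV
    have hinj : Function.Injective f := by
      intro a b hab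
      exact huniq a b _ (hf a) (hab ▸ hf b)
    have := Fintype.card_le_of_injective f hinj
    simp at this
  choose q hq using hQ
  have hqinj : Function.Injective q := by
    intro a b hab
    exact huniq a b _ (hq a) (hab ▸ hq b)
  have hqbij : Function.Bijective q := by
    rw [Fintype.bijective_iff_injective_and_card]
    refine ⟨hqinj, ?_⟩
    simp
    omega
  obtain ⟨r, hrl, hrr⟩ := Function.bijective_iff_has_inverse.1 hqbij
  have hrinj : Function.Injective r := hrr.injective
  have hmem : ∀ x, cliqueEmb s t (Fintype.card V + 1 - 2 * k) x ∈ S (r x) := by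
    intro x
    have := hq (r x)
    rwa [hrr x] at this
  have hback : ∀ x y, cliqueEmb s t (Fintype.card V + 1 - 2 * k) x ∈ S (r y) → x = y :=
    fun x y h => hrinj (huniq _ _ _ (hmem x) h)
  have key : ∀ i : Fin k, ∃ P : G.Walk (s i) (t i), P.IsPath ∧ ∀ v ∈ P.support,
      (Sum.inl v : V ⊕ Fin (Fintype.card V + 1 - 2 * k)) ∈
        S (r (Sum.inl (Sum.inl i))) ∪ S (r (Sum.inl (Sum.inr i))) := by
    intro i
    set U := S (r (Sum.inl (Sum.inl i))) ∪ S (r (Sum.inl (Sum.inr i))) with hU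
    have hUt : ∀ x, cliqueEmb s t (Fintype.card V + 1 - 2 * k) x ∈ U →
        x = Sum.inl (Sum.inl i) ∨ x = Sum.inl (Sum.inr i) := by
      rintro x (h | h)
      · exact Or.inl (hback _ _ h)
      · exact Or.inr (hback _ _ h)
    have hterm : ∀ v, Sum.inl v ∈ U → IsTerminal s t v → v = s i ∨ v = t i := by
      rintro v hv (⟨l, rfl⟩ | ⟨l, rfl⟩)
      · have := hUt (Sum.inl (Sum.inl l)) hv
        simp at this
        simp [this]
      · have := hUt (Sum.inl (Sum.inr l)) hv
        simp at this
        simp [this]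
    have hinl : ∀ x : U, ∃ v, x.1 = Sum.inl v := by
      rintro ⟨v | w, hx⟩
      · exact ⟨v, rfl⟩
      · have := hUt (Sum.inr w) hx
        simp at this
    choose f hf using hinl
    have hcU : ((Gdp G s t (Fintype.card V + 1 - 2 * k)).induce U).Connected := by
      obtain ⟨x, hx, y, hy, hxy⟩ := hadj (r (Sum.inl (Sum.inl i))) (r (Sum.inl (Sum.inr i)))
        (fun h => by simpa using hrinj h)
      exact SimpleGraph.connected_induce_union (hconn _).preconnected (hconn _).preconnected hx hy hxy
    let φ : ((Gdp G s t (Fintype.card V + 1 - 2 * k)).induce U) →g G :=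
      { toFun := f
        map_rel' := by
          intro a b hab
          have hab' : (Gdp G s t (Fintype.card V + 1 - 2 * k)).Adj a.1 b.1 := hab
          have ha := a.2
          have hb := b.2
          rw [hf a, hf b] at hab'
          rw [hf a] at ha
          rw [hf b] at hb
          obtain ⟨hn, h | ⟨h1, h2, h3⟩⟩ := Gdp_inl_adj _ _ _ _ _ _ hab'
          · exact h
          · exfalso
            rcases hterm _ ha h1 with e1 | e1 <;> rcases hterm _ hb h2 with e2 | e2
            · exact hn (e1.trans e2.symm)
            · exact h3 ⟨i, Or.inl ⟨e1, e2⟩⟩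
            · exact h3 ⟨i, Or.inr ⟨e1, e2⟩⟩
            · exact hn (e1.trans e2.symm) }
    let a : U := ⟨Sum.inl (s i), Or.inl (hmem (Sum.inl (Sum.inl i)))⟩
    let b : U := ⟨Sum.inl (t i), Or.inr (hmem (Sum.inl (Sum.inr i)))⟩
    obtain ⟨p⟩ := hcU.preconnected a b
    have ea : φ a = s i := (Sum.inl.inj (hf a)).symm
    have eb : φ b = t i := (Sum.inl.inj (hf b)).symm
    refine ⟨((p.map φ).copy ea eb).bypass, SimpleGraph.Walk.bypass_isPath _, ?_⟩
    intro v hv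
    have hv := SimpleGraph.Walk.support_bypass_subset _ hv
    rw [SimpleGraph.Walk.support_copy, SimpleGraph.Walk.support_map, List.mem_map] at hv
    obtain ⟨x, -, rfl⟩ := hv
    have := x.2
    rw [hf x] at this
    exact this
  choose P hP hPs using key
  refine ⟨P, hP, ?_⟩
  intro i j hij v hi hj
  have hi := hPs i v hi
  have hj := hPs j v hj
  rcases hi with hi | hi <;> rcases hj with hj | hj <;>
  · have := hrinj (huniq _ _ _ hi hj)
    simp at this
    try exact hij this
end
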